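/- Let k be an algebraically closed field and A a spectroid over k, and let f : M → N be an irreducible epimorphism in mod A. If N is finitely co-generated, then ker(f) is finitely co-presented; likewise, if the canonical kernel morphism ker(f) → M is also irreducible, then ker(f) is finitely co-presented. -/

import Mathlib

open CategoryTheory CategoryTheory.Limits

namespace Paper

variable (k : Type) [Field k]

section General

variable (A : Type) [Category.{0} A] [Preadditive A] [CategoryTheory.Linear k A]

/-- A spectroid over `k`: a (small) Hom-finite `k`-linear category in which every object
has a local endomorphism ring and distinct objects are not isomorphic. -/
class Spectroid : Prop where
  homFinite : ∀ a b : A, FiniteDimensional k (a ⟶ b)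
  localEnd : ∀ a : A, IsLocalRing (End a)
  skeletal : ∀ a b : A, (a ≅ b) → a = b

variable {A}

/-- `M` is a module over `A`, i.e. the functor `M : A ⥤ ModuleCat k` is additive and
`k`-linear on morphisms. -/
def IsMod (M : A ⥤ ModuleCat.{0} k) : Prop :=
  (∀ {a b : A} (f g : a ⟶ b), M.map (f + g) = M.map f + M.map g) ∧
  (∀ {a b : A} (r : k) (f : a ⟶ b), M.map (r • f) = r • M.map f)

/-- `M` is a locally finite dimensional module over `A`, i.e. an object of `mod A`. -/
def IsLfdMod (M : A ⥤ ModuleCat.{0} k) : Prop :=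
  IsMod k M ∧ ∀ a : A, FiniteDimensional k (M.obj a)

/-- The projective module `P_a = Hom_A(a, -)` at an object `a`. -/
noncomputable def ProjAt (a : A) : A ⥤ ModuleCat.{0} k :=
  (linearCoyoneda k A).obj (Opposite.op a)

/-- The injective module `I_a = D Hom_A(-, a)` at an object `a`. -/
noncomputable def InjAt (a : A) : A ⥤ ModuleCat.{0} k where
  obj b := ModuleCat.of k (Module.Dual k (b ⟶ a))
  map {b c} f := ModuleCat.ofHom (LinearMap.dualMap (Linear.leftComp k a f))
  map_id b := by
    have h : Linear.leftComp k a (𝟙 b) = LinearMap.id := by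
      apply LinearMap.ext; intro g; simp
    rw [h, LinearMap.dualMap_id]; rfl
  map_comp {b c d} f g := by
    have h : Linear.leftComp k a (f ≫ g) =
        (Linear.leftComp k a f).comp (Linear.leftComp k a g) := by
      apply LinearMap.ext; intro h; simp
    rw [h]; rfl

instance : HasFiniteBiproducts (A ⥤ ModuleCat.{0} k) :=
  CategoryTheory.Abelian.hasFiniteBiproducts

/-- `M` is finitely generated: there is an epimorphism `⊕_{i=1}^r P_{a_i} → M`. -/
def IsFG (M : A ⥤ ModuleCat.{0} k) : Prop :=
  ∃ (r : ℕ) (a : Fin r → A) (f : (⨁ fun i => ProjAt k (a i)) ⟶ M), Epi f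

/-- `M` is finitely presented: there is an epimorphism `⊕_{i=1}^r P_{a_i} → M` with
finitely generated kernel. -/
def IsFP (M : A ⥤ ModuleCat.{0} k) : Prop :=
  ∃ (r : ℕ) (a : Fin r → A) (f : (⨁ fun i => ProjAt k (a i)) ⟶ M),
    Epi f ∧ IsFG k (kernel f)

/-- `M` is finitely co-generated: there is a monomorphism `M → ⊕_{j=1}^s I_{b_j}`. -/
def IsFCG (M : A ⥤ ModuleCat.{0} k) : Prop :=
  ∃ (s : ℕ) (b : Fin s → A) (f : M ⟶ ⨁ fun j => InjAt k (b j)), Mono f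

/-- `M` is finitely co-presented: there is a monomorphism `M → ⊕_{j=1}^s I_{b_j}` with
finitely co-generated cokernel. -/
def IsFCP (M : A ⥤ ModuleCat.{0} k) : Prop :=
  ∃ (s : ℕ) (b : Fin s → A) (f : M ⟶ ⨁ fun j => InjAt k (b j)),
    Mono f ∧ IsFCG k (cokernel f)

/-- `f` is an irreducible morphism in `mod A`: it is neither a split mono nor a split epi,
and in any factorization `f = g ≫ h` through an object of `mod A`, `g` is a split mono
or `h` is a split epi. -/
def Irred {L M : A ⥤ ModuleCat.{0} k} (f : L ⟶ M) : Prop :=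
  ¬ IsSplitMono f ∧ ¬ IsSplitEpi f ∧
    ∀ ⦃X : A ⥤ ModuleCat.{0} k⦄, IsLfdMod k X →
      ∀ (g : L ⟶ X) (h : X ⟶ M), g ≫ h = f → IsSplitMono g ∨ IsSplitEpi h

/-- `M` is an indecomposable object of `mod A`: it is nonzero, and whenever `M ≅ X ⊞ Y`
with `X`, `Y` in `mod A`, one of `X`, `Y` is zero. -/
def Indec (M : A ⥤ ModuleCat.{0} k) : Prop :=
  ¬ IsZero M ∧ ∀ ⦃X Y : A ⥤ ModuleCat.{0} k⦄, IsLfdMod k X → IsLfdMod k Y →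
    (M ≅ X ⊞ Y) → IsZero X ∨ IsZero Y

/-- `0 → L →f M →g N → 0` is an almost split sequence in `mod A`. -/
structure AlmostSplitSeq {L M N : A ⥤ ModuleCat.{0} k} (f : L ⟶ M) (g : M ⟶ N) : Prop where
  mono : Mono f
  epi : Epi g
  zero : f ≫ g = 0
  exact : (ShortComplex.mk f g zero).Exact
  not_splitMono : ¬ IsSplitMono f
  not_splitEpi : ¬ IsSplitEpi g
  left_almost_split : ∀ ⦃X : A ⥤ ModuleCat.{0} k⦄, IsLfdMod k X →
    ∀ u : L ⟶ X, ¬ IsSplitMono u → ∃ v : M ⟶ X, f ≫ v = u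
  right_almost_split : ∀ ⦃X : A ⥤ ModuleCat.{0} k⦄, IsLfdMod k X →
    ∀ u : X ⟶ N, ¬ IsSplitEpi u → ∃ v : X ⟶ M, v ≫ g = u

/-- `M` is projective as an object of `mod A`. -/
def ProjInMod (M : A ⥤ ModuleCat.{0} k) : Prop :=
  ∀ ⦃X Y : A ⥤ ModuleCat.{0} k⦄, IsLfdMod k X → IsLfdMod k Y →
    ∀ (e : X ⟶ Y), Epi e → ∀ u : M ⟶ Y, ∃ t : M ⟶ X, t ≫ e = u

/-- `M` is injective as an object of `mod A`. -/
def InjInMod (M : A ⥤ ModuleCat.{0} k) : Prop :=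
  ∀ ⦃X Y : A ⥤ ModuleCat.{0} k⦄, IsLfdMod k X → IsLfdMod k Y →
    ∀ (m : X ⟶ Y), Mono m → ∀ u : X ⟶ M, ∃ t : Y ⟶ M, m ≫ t = u

/-- `h` is a (nonempty) composition of irreducible morphisms between indecomposable
objects of `mod A`. -/
inductive IrredChain : ∀ {X Y : A ⥤ ModuleCat.{0} k}, (X ⟶ Y) → Prop
  | single {X Y : A ⥤ ModuleCat.{0} k} (f : X ⟶ Y) :
      IsLfdMod k X → Indec k X → IsLfdMod k Y → Indec k Y → Irred k f → IrredChain f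
  | comp {X Y Z : A ⥤ ModuleCat.{0} k} (f : X ⟶ Y) (g : Y ⟶ Z) :
      IsLfdMod k X → Indec k X → Irred k f → IrredChain g → IrredChain (f ≫ g)

end General

section QuiverSection

variable (Q : Type) [Quiver.{0} Q]

/-- `Q` is locally finite: every vertex is the source of finitely many arrows and the
target of finitely many arrows. -/
def LocallyFinite : Prop :=
  ∀ x : Q, Finite (Σ y : Q, x ⟶ y) ∧ Finite (Σ y : Q, y ⟶ x)

/-- `Q` is interval finite: there are finitely many paths between any two vertices. -/
def IntervalFinite : Prop :=
  ∀ x y : Q, Finite (Quiver.Path x y)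

/-- `Q` is strongly locally finite: locally finite and interval finite. -/
def StronglyLocallyFinite : Prop :=
  LocallyFinite Q ∧ IntervalFinite Q

/-- `Q` is connected: nonempty, and any two vertices are joined by a walk. -/
def QuiverConnected : Prop :=
  Nonempty Q ∧ ∀ x y : Q,
    Nonempty (Quiver.Path (Quiver.Symmetrify.of.obj x) (Quiver.Symmetrify.of.obj y))

/-- The path category `kQ` of the quiver `Q`: the free `k`-linear category on the free
category on `Q`. -/
abbrev PathCat := CategoryTheory.Free k (Paths Q)

/-- A vertex of `Q`, seen as an object of the path category `kQ`. -/
noncomputable def vtx (x : Q) : PathCat k Q :=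
  (Free.embedding k (Paths Q)).obj ((Paths.of Q).obj x)

/-- An arrow of `Q`, seen as a morphism of the path category `kQ`. -/
noncomputable def arrHom {x y : Q} (α : x ⟶ y) : vtx k Q x ⟶ vtx k Q y :=
  (Free.embedding k (Paths Q)).map ((Paths.of Q).map α)

/-- The degree of a vertex of `Q`: the total number of arrows incident to it. -/
noncomputable def degree (x : Q) : ℕ :=
  Nat.card ((Σ y : Q, x ⟶ y) ⊕ (Σ y : Q, y ⟶ x))

/-- `M` belongs to `rrep(Q)`: it is the middle term of a short exact sequence
`0 → L → M → N → 0` with `L` finitely presented, `N` finitely co-presented, and only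
finitely many arrows `α` of `Q` satisfy `M(α) ≠ 0`, `L(α) = 0` and `N(α) = 0`. -/
def InRrep (M : PathCat k Q ⥤ ModuleCat.{0} k) : Prop :=
  ∃ (L N : PathCat k Q ⥤ ModuleCat.{0} k) (f : L ⟶ M) (g : M ⟶ N) (zero : f ≫ g = 0),
    Mono f ∧ Epi g ∧ (ShortComplex.mk f g zero).Exact ∧ IsFP k L ∧ IsFCP k N ∧
    Set.Finite {p : Σ (x : Q) (y : Q), x ⟶ y |
      M.map (arrHom k Q p.2.2) ≠ 0 ∧ L.map (arrHom k Q p.2.2) = 0 ∧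
      N.map (arrHom k Q p.2.2) = 0}

variable {Q}

/-- The vertices occurring in a path. -/
def InPath {x : Q} : ∀ {y : Q}, Quiver.Path x y → Q → Prop
  | _, Quiver.Path.nil, v => v = x
  | _, @Quiver.Path.cons _ _ _ _ c p _, v => v = c ∨ InPath p v

variable (Q)

/-- `Q` is a star quiver: it is obtained from a finite full convex subquiver `Γ` by
attaching finitely many rays and co-rays with no common vertices. -/
def IsStarQuiver : Prop :=
  ∃ (Γ S₁ S₂ : Set Q) (v : Q → ℕ → Q),
    Γ.Finite ∧ S₁ ⊆ Γ ∧ S₂ ⊆ Γ ∧ Disjoint S₁ S₂ ∧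
    (∀ x y : Q, x ∈ Γ → y ∈ Γ → ∀ p : Quiver.Path x y, ∀ z : Q, InPath p z → z ∈ Γ) ∧
    (∀ s ∈ S₁ ∪ S₂, ∀ i : ℕ, v s i ∉ Γ) ∧
    (∀ s ∈ S₁ ∪ S₂, ∀ t ∈ S₁ ∪ S₂, ∀ i j : ℕ, v s i = v t j → s = t ∧ i = j) ∧
    (∀ x : Q, x ∉ Γ → ∃ s ∈ S₁ ∪ S₂, ∃ i : ℕ, x = v s i) ∧
    (∀ s ∈ S₁, Nat.card (s ⟶ v s 0) = 1 ∧ ∀ i : ℕ, Nat.card (v s i ⟶ v s (i + 1)) = 1) ∧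
    (∀ s ∈ S₂, Nat.card (v s 0 ⟶ s) = 1 ∧ ∀ i : ℕ, Nat.card (v s (i + 1) ⟶ v s i) = 1) ∧
    (∀ x y : Q, (x ⟶ y) → ¬(x ∈ Γ ∧ y ∈ Γ) →
      (∃ s ∈ S₁, (x = s ∧ y = v s 0) ∨ ∃ i : ℕ, x = v s i ∧ y = v s (i + 1)) ∨
      (∃ s ∈ S₂, (x = v s 0 ∧ y = s) ∨ ∃ i : ℕ, x = v s (i + 1) ∧ y = v s i))

end QuiverSection

section Cogeneration

/-- A family of linear equations over a field, stated in a dual space, is solvable as soon as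
all of its finite subfamilies are. -/
lemma exists_dual_of_finite {k V ι : Type*} [Field k] [AddCommGroup V] [Module k V]
    (v : ι → V) (c : ι → k)
    (h : ∀ T : Finset ι, ∃ ρ : Module.Dual k V, ∀ i ∈ T, ρ (v i) = c i) :
    ∃ ρ : Module.Dual k V, ∀ i, ρ (v i) = c i := by
  set W : Submodule k (V × k) := Submodule.span k (Set.range fun i => (v i, c i))
  have hnot : ((0, 1) : V × k) ∉ W := by
    intro hmem
    obtain ⟨t, ht⟩ := (Finsupp.mem_span_range_iff_exists_finsupp).1 hmem
    obtain ⟨ρ, hρ⟩ := h t.support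
    have h1 : t.sum (fun i a => a • v i) = 0 := by
      have := congrArg (LinearMap.fst k V k) ht
      simpa [Finsupp.sum, map_sum] using this
    have h2 : t.sum (fun i a => a • c i) = 1 := by
      have := congrArg (LinearMap.snd k V k) ht
      simpa [Finsupp.sum, map_sum] using this
    have h3 : ρ (t.sum (fun i a => a • v i)) = t.sum (fun i a => a • c i) := by
      simp only [Finsupp.sum, map_sum, map_smul]
      exact Finset.sum_congr rfl fun i hi => by rw [hρ i hi]
    rw [h1, h2, map_zero] at h3
    exact zero_ne_one h3
  obtain ⟨Φ, hΦ, hle⟩ := Submodule.exists_le_ker_of_notMem hnot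
  refine ⟨-(Φ (0, 1))⁻¹ • Φ.comp (LinearMap.inl k V k), fun i => ?_⟩
  have hi : Φ (v i, c i) = 0 := hle (Submodule.subset_span ⟨i, rfl⟩)
  have hsplit : (v i, c i) = (v i, 0) + c i • ((0, 1) : V × k) := by simp
  rw [hsplit, map_add, map_smul, smul_eq_mul] at hi
  have : Φ (v i, 0) = -(c i * Φ (0, 1)) := eq_neg_of_add_eq_zero_left hi
  simp [this]
  field_simp

variable {k}
variable {A : Type} [Category.{0} A]

lemma app_map {X Y : A ⥤ ModuleCat.{0} k} (φ : X ⟶ Y) {c d : A} (g : c ⟶ d) (x : X.obj c) :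
    φ.app d (X.map g x) = Y.map g (φ.app c x) := by
  have := congrArg (fun h => h.hom x) (φ.naturality g)
  exact this

lemma comp_app_apply {X Y Z : A ⥤ ModuleCat.{0} k} (φ : X ⟶ Y) (ψ : Y ⟶ Z) (c : A)
    (x : X.obj c) : (φ ≫ ψ).app c x = ψ.app c (φ.app c x) := rfl

lemma map_comp_apply (X : A ⥤ ModuleCat.{0} k) {c d e : A} (g : c ⟶ d) (h : d ⟶ e)
    (x : X.obj c) : X.map (g ≫ h) x = X.map h (X.map g x) := by simp

lemma hom_ext_apply {X Y : A ⥤ ModuleCat.{0} k} {φ ψ : X ⟶ Y}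
    (h : ∀ c (x : X.obj c), φ.app c x = ψ.app c x) : φ = ψ := by
  ext c x; exact h c x

lemma mono_iff_app_injective {X Y : A ⥤ ModuleCat.{0} k} (φ : X ⟶ Y) :
    Mono φ ↔ ∀ c, Function.Injective (φ.app c) := by
  simp only [NatTrans.mono_iff_mono_app, ModuleCat.mono_iff_injective]

lemma epi_iff_app_surjective {X Y : A ⥤ ModuleCat.{0} k} (φ : X ⟶ Y) :
    Epi φ ↔ ∀ c, Function.Surjective (φ.app c) := by
  simp only [NatTrans.epi_iff_epi_app, ModuleCat.epi_iff_surjective]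

lemma exists_of_exact {S : ShortComplex (A ⥤ ModuleCat.{0} k)} (hS : S.Exact) (c : A)
    (y : S.X₂.obj c) (hy : S.g.app c y = 0) : ∃ x, S.f.app c x = y :=
  (ShortComplex.moduleCat_exact_iff _).1 (hS.map ((evaluation A (ModuleCat.{0} k)).obj c)) y hy

lemma exists_kernel_ι_eq {X Y : A ⥤ ModuleCat.{0} k} (φ : X ⟶ Y) (c : A) (x : X.obj c)
    (hx : φ.app c x = 0) : ∃ z, (kernel.ι φ).app c z = x :=
  exists_of_exact (S := ShortComplex.mk _ _ (kernel.condition φ))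
    (ShortComplex.exact_kernel φ) c x hx

lemma exists_of_cokernel_π_eq_zero {X Y : A ⥤ ModuleCat.{0} k} (φ : X ⟶ Y) (c : A)
    (y : Y.obj c) (hy : (cokernel.π φ).app c y = 0) : ∃ x, φ.app c x = y :=
  exists_of_exact (S := ShortComplex.mk _ _ (cokernel.condition φ))
    (ShortComplex.exact_cokernel φ) c y hy

lemma app_apply_of_comp_eq_zero {X Y Z : A ⥤ ModuleCat.{0} k} {φ : X ⟶ Y} {ψ : Y ⟶ Z}
    (h : φ ≫ ψ = 0) (c : A) (x : X.obj c) : ψ.app c (φ.app c x) = 0 := by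
  rw [← comp_app_apply, h]; rfl

/-- A morphism of pointwise finite-dimensional functors is a split epimorphism as soon as its
restrictions to all finite sets of objects are. -/
lemma isSplitEpi_of_finite {M N : A ⥤ ModuleCat.{0} k}
    (hM : ∀ a, FiniteDimensional k (M.obj a)) (hN : ∀ a, FiniteDimensional k (N.obj a))
    (f : M ⟶ N)
    (h : ∀ S : Finset A, ∃ s : ∀ a, N.obj a →ₗ[k] M.obj a,
      (∀ a ∈ S, ∀ x, f.app a (s a x) = x) ∧
      ∀ a ∈ S, ∀ b ∈ S, ∀ (g : a ⟶ b) x, s b (N.map g x) = M.map g (s a x)) :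
    IsSplitEpi f := by
  classical
  let H : A → Type := fun a => N.obj a →ₗ[k] M.obj a
  let V := Module.Dual k (∀ a, H a)
  let secEq : ∀ a, Module.Dual k (N.obj a →ₗ[k] N.obj a) → V := fun a θ =>
    (θ ∘ₗ LinearMap.llcomp k (N.obj a) (M.obj a) (N.obj a) (f.app a).hom) ∘ₗ LinearMap.proj a
  let natL : ∀ {a b : A}, (a ⟶ b) → Module.Dual k (N.obj a →ₗ[k] M.obj b) →
      Module.Dual k (H b) := fun {a b} g θ => θ ∘ₗ LinearMap.lcomp k (M.obj b) (N.map g).hom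
  let natR : ∀ {a b : A}, (a ⟶ b) → Module.Dual k (N.obj a →ₗ[k] M.obj b) →
      Module.Dual k (H a) := fun {a b} g θ =>
        θ ∘ₗ LinearMap.llcomp k (N.obj a) (M.obj a) (M.obj b) (M.map g).hom
  let I := (Σ a, Module.Dual k (N.obj a →ₗ[k] N.obj a)) ⊕
    (Σ p : (Σ a b : A, (a ⟶ b)), Module.Dual k (N.obj p.1 →ₗ[k] M.obj p.2.1))
  let v : I → V := Sum.elim (fun i => secEq i.1 i.2)
    (fun i => natL i.1.2.2 i.2 ∘ₗ LinearMap.proj i.1.2.1 -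
      natR i.1.2.2 i.2 ∘ₗ LinearMap.proj i.1.1)
  let c : I → k := Sum.elim (fun i => i.2 LinearMap.id) (fun _ => 0)
  obtain ⟨ρ, hρ⟩ := exists_dual_of_finite v c (by
    intro T
    obtain ⟨s, hs, hnat⟩ := h (T.biUnion (Sum.elim (fun i => {i.1})
      (fun i => {i.1.1, i.1.2.1})))
    refine ⟨Module.Dual.eval k _ s, ?_⟩
    rintro (⟨a, θ⟩ | ⟨⟨a, b, g⟩, θ⟩) hi
    · have ha := hs a (Finset.mem_biUnion.2 ⟨_, hi, by simp⟩)
      have : (f.app a).hom ∘ₗ s a = LinearMap.id := LinearMap.ext ha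
      change θ ((f.app a).hom ∘ₗ s a) = θ LinearMap.id
      rw [this]
    · have ha := hnat a (Finset.mem_biUnion.2 ⟨_, hi, by simp⟩) b
        (Finset.mem_biUnion.2 ⟨_, hi, by simp⟩) g
      have : s b ∘ₗ (N.map g).hom = (M.map g).hom ∘ₗ s a := LinearMap.ext ha
      change θ (s b ∘ₗ (N.map g).hom) - θ ((M.map g).hom ∘ₗ s a) = 0
      rw [this, sub_self])
  let s : ∀ a, H a := fun a =>
    (Module.evalEquiv k (H a)).symm (ρ ∘ₗ (LinearMap.proj (φ := H) (R := k) a).dualMap)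
  have hs : ∀ a (ξ : Module.Dual k (H a)), ξ (s a) = ρ (ξ ∘ₗ LinearMap.proj a) := by
    intro a ξ
    exact Module.apply_evalEquiv_symm_apply k (H a) ξ _
  have hsec : ∀ a, (f.app a).hom ∘ₗ s a = LinearMap.id := by
    intro a
    rw [← sub_eq_zero, ← Module.forall_dual_apply_eq_zero_iff k]
    intro θ
    have h1 := hρ (Sum.inl ⟨a, θ⟩)
    have h2 := hs a (θ ∘ₗ LinearMap.llcomp k (N.obj a) (M.obj a) (N.obj a) (f.app a).hom)
    rw [map_sub, sub_eq_zero]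
    exact h2.trans h1
  have hnat : ∀ {a b : A} (g : a ⟶ b),
      s b ∘ₗ (N.map g).hom = (M.map g).hom ∘ₗ s a := by
    intro a b g
    rw [← sub_eq_zero, ← Module.forall_dual_apply_eq_zero_iff k]
    intro θ
    have h1 : ρ (natL g θ ∘ₗ LinearMap.proj b - natR g θ ∘ₗ LinearMap.proj a) = 0 :=
      hρ (Sum.inr ⟨⟨a, b, g⟩, θ⟩)
    rw [map_sub, ← hs b, ← hs a] at h1
    rw [map_sub]
    exact h1
  exact ⟨⟨{ section_ := { app := fun a => ModuleCat.ofHom (s a)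
                          naturality := fun a b g => ModuleCat.hom_ext (hnat g) }
            id := hom_ext_apply fun a x => LinearMap.congr_fun (hsec a) x }⟩⟩

/-- The subfunctor of `Y` of those elements which every morphism to an object of `S` sends into
the given submodules. -/
def closure (S : Finset A) (Y : A ⥤ ModuleCat.{0} k) (p : ∀ c, Submodule k (Y.obj c)) :
    A ⥤ ModuleCat.{0} k where
  obj c := ModuleCat.of k
    (⨅ (a : A) (_ : a ∈ S) (g : c ⟶ a), (p a).comap (Y.map g).hom : Submodule k (Y.obj c))
  map {c d} g := ModuleCat.ofHom ((Y.map g).hom.restrict (by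
    intro x hx
    simp only [Submodule.mem_iInf, Submodule.mem_comap] at hx ⊢
    intro a ha h
    rw [← map_comp_apply]
    exact hx a ha _))
  map_id c := by
    ext x
    exact LinearMap.congr_fun (congrArg ModuleCat.Hom.hom (Y.map_id c)) x.1
  map_comp g h := by
    ext x
    exact LinearMap.congr_fun (congrArg ModuleCat.Hom.hom (Y.map_comp g h)) x.1

/-- The inclusion of `closure S Y p` into `Y`. -/
def closureι (S : Finset A) (Y : A ⥤ ModuleCat.{0} k) (p : ∀ c, Submodule k (Y.obj c)) :
    closure S Y p ⟶ Y where
  app _ := ModuleCat.ofHom (Submodule.subtype _)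
  naturality _ _ _ := rfl

section closure

variable (S : Finset A) (Y : A ⥤ ModuleCat.{0} k) (p : ∀ c, Submodule k (Y.obj c))

lemma closureι_injective (c : A) : Function.Injective ((closureι S Y p).app c) :=
  Subtype.val_injective

instance : Mono (closureι S Y p) := (mono_iff_app_injective _).2 (closureι_injective S Y p)

variable {S Y p}

lemma map_closureι_mem {c : A} (x : (closure S Y p).obj c) {a : A} (ha : a ∈ S) (g : c ⟶ a) :
    Y.map g ((closureι S Y p).app c x) ∈ p a := by
  have hx := x.2
  simp only [Submodule.mem_iInf, Submodule.mem_comap] at hx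
  exact hx a ha g

lemma closureι_mem {a : A} (ha : a ∈ S) (x : (closure S Y p).obj a) :
    (closureι S Y p).app a x ∈ p a := by
  simpa using map_closureι_mem x ha (𝟙 a)

lemma exists_closureι_eq {c : A} (y : Y.obj c)
    (hy : ∀ a ∈ S, ∀ g : c ⟶ a, Y.map g y ∈ p a) : ∃ x, (closureι S Y p).app c x = y :=
  ⟨⟨y, by simpa only [Submodule.mem_iInf, Submodule.mem_comap] using hy⟩, rfl⟩

/-- The factorization through `closure S Y p` of a morphism with values in `p` on `S`. -/
def closureLift {X : A ⥤ ModuleCat.{0} k} (φ : X ⟶ Y)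
    (h : ∀ a ∈ S, ∀ x : X.obj a, φ.app a x ∈ p a) : X ⟶ closure S Y p where
  app c := ModuleCat.ofHom ((φ.app c).hom.codRestrict _ (by
    intro x
    simp only [Submodule.mem_iInf, Submodule.mem_comap]
    intro a ha g
    rw [← app_map]
    exact h a ha _))
  naturality c d g := by
    ext x
    exact Subtype.ext (app_map φ g x)

lemma closureLift_ι {X : A ⥤ ModuleCat.{0} k} (φ : X ⟶ Y)
    (h : ∀ a ∈ S, ∀ x : X.obj a, φ.app a x ∈ p a) :
    closureLift φ h ≫ closureι S Y p = φ := rfl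

end closure

/-- `X` is co-generated at `S`: no nonzero element of `X` is killed by all morphisms to
objects of `S`. -/
def CogenAt (S : Finset A) (X : A ⥤ ModuleCat.{0} k) : Prop :=
  ∀ ⦃c : A⦄ (x : X.obj c), (∀ a ∈ S, ∀ g : c ⟶ a, X.map g x = 0) → x = 0

lemma CogenAt.mono {S T : Finset A} {X : A ⥤ ModuleCat.{0} k} (h : CogenAt S X) (hST : S ⊆ T) :
    CogenAt T X :=
  fun _ x hx => h x fun a ha g => hx a (hST ha) g

lemma CogenAt.of_mono {S : Finset A} {X Y : A ⥤ ModuleCat.{0} k} (h : CogenAt S Y) (φ : X ⟶ Y)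
    [Mono φ] : CogenAt S X := by
  intro c x hx
  apply (mono_iff_app_injective φ).1 inferInstance c
  rw [map_zero]
  apply h
  intro a ha g
  rw [← app_map, hx a ha g, map_zero]

/-- The pointwise direct sum of two functors. -/
def prodFunctor (X Y : A ⥤ ModuleCat.{0} k) : A ⥤ ModuleCat.{0} k where
  obj c := ModuleCat.of k (X.obj c × Y.obj c)
  map g := ModuleCat.ofHom ((X.map g).hom.prodMap (Y.map g).hom)
  map_id c := by
    refine ModuleCat.hom_ext (LinearMap.ext fun x => ?_)
    exact Prod.ext (LinearMap.congr_fun (congrArg ModuleCat.Hom.hom (X.map_id c)) x.1)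
      (LinearMap.congr_fun (congrArg ModuleCat.Hom.hom (Y.map_id c)) x.2)
  map_comp g h := by
    refine ModuleCat.hom_ext (LinearMap.ext fun x => ?_)
    exact Prod.ext (LinearMap.congr_fun (congrArg ModuleCat.Hom.hom (X.map_comp g h)) x.1)
      (LinearMap.congr_fun (congrArg ModuleCat.Hom.hom (Y.map_comp g h)) x.2)

/-- The second projection of the pointwise direct sum. -/
def prodSnd (X Y : A ⥤ ModuleCat.{0} k) : prodFunctor X Y ⟶ Y where
  app _ := ModuleCat.ofHom (LinearMap.snd k _ _)
  naturality _ _ _ := rfl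

/-- The morphism to the pointwise direct sum with the given components. -/
def prodLift {W X Y : A ⥤ ModuleCat.{0} k} (φ : W ⟶ X) (ψ : W ⟶ Y) : W ⟶ prodFunctor X Y where
  app c := ModuleCat.ofHom ((φ.app c).hom.prod (ψ.app c).hom)
  naturality c d g := by
    ext x
    exact Prod.ext (app_map φ g x) (app_map ψ g x)

lemma eq_zero_of_biproduct_π {s : ℕ} (X : Fin s → (A ⥤ ModuleCat.{0} k)) (c : A)
    (x : (⨁ X).obj c) (hx : ∀ j, (biproduct.π X j).app c x = 0) : x = 0 := by
  have h : ∀ T : Finset (Fin s),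
      (∑ j ∈ T, biproduct.π X j ≫ biproduct.ι X j).app c x = 0 := by
    classical
    intro T
    induction T using Finset.induction_on with
    | empty => rfl
    | insert j T hj ih =>
      rw [Finset.sum_insert hj]
      change (biproduct.π X j ≫ biproduct.ι X j).app c x + _ = 0
      rw [ih, comp_app_apply, hx, map_zero, add_zero]
  have h1 := h Finset.univ
  rw [biproduct.total] at h1
  exact h1

section Linear

variable [Preadditive A] [CategoryTheory.Linear k A]

lemma IsLfdMod.of_epi {X Y : A ⥤ ModuleCat.{0} k} (h : IsLfdMod k X) (φ : X ⟶ Y) [Epi φ] :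
    IsLfdMod k Y := by
  have hφ := (epi_iff_app_surjective φ).1 inferInstance
  refine ⟨⟨fun {a b} f g => ?_, fun {a b} r f => ?_⟩, fun a => ?_⟩
  · ext y
    obtain ⟨x, rfl⟩ := hφ _ y
    have := congrArg (fun t => φ.app b (t.hom x)) (h.1.1 f g)
    simpa [app_map] using this
  · ext y
    obtain ⟨x, rfl⟩ := hφ _ y
    have := congrArg (fun t => φ.app b (t.hom x)) (h.1.2 r f)
    simpa [app_map] using this
  · have := h.2 a
    exact Module.Finite.of_surjective (φ.app a).hom (hφ a)

lemma IsLfdMod.of_jointly_injective {X : A ⥤ ModuleCat.{0} k} {J : Type} [Finite J]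
    {Y : J → (A ⥤ ModuleCat.{0} k)} (hY : ∀ j, IsLfdMod k (Y j)) (φ : ∀ j, X ⟶ Y j)
    (hφ : ∀ c (x : X.obj c), (∀ j, (φ j).app c x = 0) → x = 0) : IsLfdMod k X := by
  have hφ' : ∀ c (x y : X.obj c), (∀ j, (φ j).app c x = (φ j).app c y) → x = y := by
    intro c x y h
    rw [← sub_eq_zero]
    exact hφ c _ fun j => by rw [map_sub, h, sub_self]
  refine ⟨⟨fun {a b} f g => ?_, fun {a b} r f => ?_⟩, fun a => ?_⟩
  · ext x
    apply hφ'
    intro j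
    have := congrArg (fun t => t.hom ((φ j).app a x)) ((hY j).1.1 f g)
    simpa [app_map] using this
  · ext x
    apply hφ'
    intro j
    have := congrArg (fun t => t.hom ((φ j).app a x)) ((hY j).1.2 r f)
    simpa [app_map] using this
  · have := fun j => (hY j).2 a
    refine Module.Finite.of_injective (LinearMap.pi fun j => ((φ j).app a).hom) ?_
    intro x y hxy
    exact hφ' a x y fun j => congrFun hxy j

lemma IsLfdMod.of_mono {X Y : A ⥤ ModuleCat.{0} k} (h : IsLfdMod k Y) (φ : X ⟶ Y) [Mono φ] :
    IsLfdMod k X :=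
  .of_jointly_injective (J := Unit) (fun _ => h) (fun _ => φ) fun c x hx =>
    (mono_iff_app_injective φ).1 inferInstance c (by rw [hx (), map_zero])

lemma IsLfdMod.prodFunctor {X Y : A ⥤ ModuleCat.{0} k} (hX : IsLfdMod k X)
    (hY : IsLfdMod k Y) : IsLfdMod k (prodFunctor X Y) := by
  refine ⟨⟨fun {a b} f g => ?_, fun {a b} r f => ?_⟩, fun a => ?_⟩
  · ext x
    exact Prod.ext (LinearMap.congr_fun (congrArg ModuleCat.Hom.hom (hX.1.1 f g)) x.1)
      (LinearMap.congr_fun (congrArg ModuleCat.Hom.hom (hY.1.1 f g)) x.2)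
  · ext x
    exact Prod.ext (LinearMap.congr_fun (congrArg ModuleCat.Hom.hom (hX.1.2 r f)) x.1)
      (LinearMap.congr_fun (congrArg ModuleCat.Hom.hom (hY.1.2 r f)) x.2)
  · have := hX.2 a
    have := hY.2 a
    exact inferInstanceAs (Module.Finite k (X.obj a × Y.obj a))

lemma isLfdMod_injAt [Spectroid k A] (a : A) : IsLfdMod k (InjAt k a) := by
  refine ⟨⟨fun {b c} f g => ?_, fun {b c} r f => ?_⟩, fun b => ?_⟩
  · refine ModuleCat.hom_ext (LinearMap.ext fun (φ : Module.Dual k (b ⟶ a)) => ?_)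
    refine LinearMap.ext fun (h : c ⟶ a) => ?_
    change φ ((f + g) ≫ h) = φ (f ≫ h) + φ (g ≫ h)
    rw [Preadditive.add_comp]
    exact map_add φ _ _
  · refine ModuleCat.hom_ext (LinearMap.ext fun (φ : Module.Dual k (b ⟶ a)) => ?_)
    refine LinearMap.ext fun (h : c ⟶ a) => ?_
    change φ ((r • f) ≫ h) = r • φ (f ≫ h)
    rw [Linear.smul_comp]
    exact map_smul φ _ _
  · have : FiniteDimensional k (b ⟶ a) := Spectroid.homFinite (k := k) b a
    exact inferInstanceAs (Module.Finite k (Module.Dual k (b ⟶ a)))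

lemma cogenAt_injAt (a : A) : CogenAt {a} (InjAt k a) := by
  intro c (φ : Module.Dual k (c ⟶ a)) hφ
  refine LinearMap.ext fun (g : c ⟶ a) => ?_
  have h := LinearMap.congr_fun (hφ a (by simp) g) (𝟙 a)
  change φ (g ≫ 𝟙 a) = 0 at h
  rw [Category.comp_id] at h
  exact h

/-- The morphism to `I_a` given by a linear form on `X(a)`. -/
def toInjAt {X : A ⥤ ModuleCat.{0} k} (hX : IsMod k X) {a : A} (ξ : Module.Dual k (X.obj a)) :
    X ⟶ InjAt k a where
  app c := ModuleCat.ofHom (X := X.obj c) (Y := Module.Dual k (c ⟶ a))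
    (LinearMap.mk₂ k (fun x g => ξ (X.map g x)) (by simp) (by simp)
      (fun x g h => by rw [hX.1]; simp) (fun r x g => by rw [hX.2]; simp))
  naturality c d g := by
    ext x
    refine LinearMap.ext fun (h : d ⟶ a) => ?_
    change ξ (X.map h (X.map g x)) = ξ (X.map (g ≫ h) x)
    rw [map_comp_apply]

lemma toInjAt_app {X : A ⥤ ModuleCat.{0} k} (hX : IsMod k X) {a : A}
    (ξ : Module.Dual k (X.obj a)) (c : A) (x : X.obj c) (g : c ⟶ a) :
    DFunLike.coe (F := Module.Dual k (c ⟶ a)) ((toInjAt hX ξ).app c x) g = ξ (X.map g x) :=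
  rfl

lemma exists_extension_injAt {X Y : A ⥤ ModuleCat.{0} k} (hY : IsMod k Y) (i : X ⟶ Y) [Mono i]
    {a : A} (φ : X ⟶ InjAt k a) : ∃ ψ : Y ⟶ InjAt k a, i ≫ ψ = φ := by
  obtain ⟨r, hr⟩ := (i.app a).hom.exists_leftInverse_of_injective
    (LinearMap.ker_eq_bot.2 ((mono_iff_app_injective i).1 inferInstance a))
  let ξ : Module.Dual k (X.obj a) :=
    LinearMap.applyₗ (R := k) (M := (a ⟶ a)) (M₂ := k) (𝟙 a) ∘ₗ (φ.app a).hom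
  refine ⟨toInjAt hY (ξ ∘ₗ r), hom_ext_apply fun c x => ?_⟩
  refine LinearMap.ext fun (g : c ⟶ a) => ?_
  rw [comp_app_apply]
  refine (toInjAt_app hY _ c _ g).trans ?_
  rw [← app_map]
  have h1 : r ((i.app a).hom (X.map g x)) = X.map g x := LinearMap.congr_fun hr _
  have h2 : φ.app a (X.map g x) = (InjAt k a).map g (φ.app c x) := app_map φ g x
  change ξ (r ((i.app a).hom (X.map g x))) = _
  rw [h1]
  change DFunLike.coe (F := Module.Dual k (a ⟶ a)) (φ.app a (X.map g x)) (𝟙 a) = _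
  rw [h2]
  change DFunLike.coe (F := Module.Dual k (c ⟶ a)) (φ.app c x) (g ≫ 𝟙 a) = _
  rw [Category.comp_id]

lemma isLfdMod_biproduct_injAt [Spectroid k A] {s : ℕ} (b : Fin s → A) :
    IsLfdMod k (⨁ fun j => InjAt k (b j)) :=
  .of_jointly_injective (fun j => isLfdMod_injAt (b j)) (fun j => biproduct.π _ j)
    fun c x hx => eq_zero_of_biproduct_π _ c x hx

lemma exists_cogenAt_biproduct_injAt {s : ℕ} (b : Fin s → A) :
    ∃ S : Finset A, CogenAt S (⨁ fun j => InjAt k (b j)) := by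
  classical
  refine ⟨Finset.univ.image b, fun c x hx => eq_zero_of_biproduct_π _ c x fun j => ?_⟩
  apply cogenAt_injAt (b j)
  intro a ha g
  rw [Finset.mem_singleton] at ha
  subst ha
  rw [← app_map, hx _ (by simp) g, map_zero]

lemma exists_extension_biproduct_injAt {X Y : A ⥤ ModuleCat.{0} k} (hY : IsMod k Y) (i : X ⟶ Y)
    [Mono i] {s : ℕ} (b : Fin s → A) (φ : X ⟶ ⨁ fun j => InjAt k (b j)) :
    ∃ ψ : Y ⟶ ⨁ fun j => InjAt k (b j), i ≫ ψ = φ := by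
  choose ψ hψ using fun j => exists_extension_injAt hY i (φ ≫ biproduct.π _ j)
  exact ⟨biproduct.lift ψ, biproduct.hom_ext _ _ fun j => by simp [hψ]⟩

lemma IsFCG.exists_cogenAt {X : A ⥤ ModuleCat.{0} k} (h : IsFCG k X) :
    ∃ S : Finset A, CogenAt S X := by
  obtain ⟨s, b, φ, hφ⟩ := h
  obtain ⟨S, hS⟩ := exists_cogenAt_biproduct_injAt (k := k) b
  exact ⟨S, hS.of_mono φ⟩

lemma CogenAt.isFCG {S : Finset A} {X : A ⥤ ModuleCat.{0} k} (h : CogenAt S X)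
    (hX : IsLfdMod k X) : IsFCG k X := by
  have hfin := hX.2
  let J := Σ a : S, Fin (Module.finrank k (X.obj a))
  let e : J ≃ Fin (Fintype.card J) := Fintype.equivFin J
  let φ : ∀ j : J, X ⟶ InjAt k j.1 := fun j =>
    toInjAt hX.1 ((Module.finBasis k (X.obj j.1)).coord j.2)
  refine ⟨Fintype.card J, fun i => (e.symm i).1, biproduct.lift fun i => φ (e.symm i), ?_⟩
  rw [mono_iff_app_injective]
  intro c
  rw [injective_iff_map_eq_zero]
  intro x hx
  apply h
  intro a ha g
  apply (Module.finBasis k (X.obj a)).ext_elem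
  intro i
  let j : J := ⟨⟨a, ha⟩, i⟩
  have h1 : ∀ i, (φ (e.symm i)).app c x = 0 := by
    intro i
    rw [← biproduct.lift_π (fun i => φ (e.symm i)) i, comp_app_apply, hx, map_zero]
  have h2 : (φ j).app c x = 0 := by
    rw [← e.symm_apply_apply j]
    exact h1 _
  rw [map_zero]
  exact LinearMap.congr_fun h2 g

end Linear

end Cogeneration

section Irreducible

variable {k}
variable {A : Type} [Category.{0} A]

/-- The restriction of `f` to the full subcategory on `S` admits a section. -/
def SplitOn (S : Finset A) {M N : A ⥤ ModuleCat.{0} k} (f : M ⟶ N) : Prop :=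
  ∃ s : ∀ a, N.obj a →ₗ[k] M.obj a, (∀ a ∈ S, ∀ x, f.app a (s a x) = x) ∧
    ∀ a ∈ S, ∀ b ∈ S, ∀ (g : a ⟶ b) x, s b (N.map g x) = M.map g (s a x)

lemma SplitOn.anti {S T : Finset A} {M N : A ⥤ ModuleCat.{0} k} {f : M ⟶ N} (h : SplitOn T f)
    (hST : S ⊆ T) : SplitOn S f := by
  obtain ⟨s, hs, hnat⟩ := h
  exact ⟨s, fun a ha => hs a (hST ha), fun a ha b hb => hnat a (hST ha) b (hST hb)⟩

lemma splitOn_of_forall_eq_zero {S : Finset A} {M N : A ⥤ ModuleCat.{0} k} (f : M ⟶ N)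
    (h : ∀ a ∈ S, ∀ x : N.obj a, x = 0) : SplitOn S f :=
  ⟨fun _ => 0, fun a ha x => by rw [h a ha x, map_zero, map_zero],
    fun a _ b _ g x => by simp⟩

/-- A morphism `f` with a factorization `i ≫ q`, where `i` is invertible on `S`
and `q` has a section, admits a section on `S`. -/
lemma splitOn_of_comp {S : Finset A} {M X N : A ⥤ ModuleCat.{0} k} {f : M ⟶ N} (i : M ⟶ X)
    (q : X ⟶ N) (hiq : i ≫ q = f) (hi : ∀ a ∈ S, Function.Bijective (i.app a))
    (hq : IsSplitEpi q) : SplitOn S f := by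
  classical
  let t : ∀ a, X.obj a →ₗ[k] M.obj a := fun a =>
    if ha : a ∈ S then (LinearEquiv.ofBijective (i.app a).hom (hi a ha)).symm.toLinearMap else 0
  have ht : ∀ a ∈ S, ∀ x, i.app a (t a x) = x := by
    intro a ha x
    simp only [t, dif_pos ha]
    exact (LinearEquiv.ofBijective (i.app a).hom (hi a ha)).apply_symm_apply x
  obtain ⟨⟨σ, hσ⟩⟩ := hq
  refine ⟨fun a => t a ∘ₗ (σ.app a).hom, fun a ha x => ?_, fun a ha b hb g x => ?_⟩
  · rw [← hiq, comp_app_apply]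
    change q.app a (i.app a (t a (σ.app a x))) = x
    rw [ht a ha, ← comp_app_apply, hσ]
    rfl
  · apply (hi b hb).1
    change i.app b (t b (σ.app b (N.map g x))) = i.app b (M.map g (t a (σ.app a x)))
    rw [ht b hb, app_map, app_map, ht a ha]

lemma exists_not_splitOn {M N : A ⥤ ModuleCat.{0} k}
    (hM : ∀ a, FiniteDimensional k (M.obj a)) (hN : ∀ a, FiniteDimensional k (N.obj a))
    {f : M ⟶ N} (hf : ¬ IsSplitEpi f) : ∃ S : Finset A, ¬ SplitOn S f := by
  by_contra! h
  exact hf (isSplitEpi_of_finite hM hN f h)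

variable [Preadditive A] [CategoryTheory.Linear k A]

lemma Irred.cogenAt_kernel {M N : A ⥤ ModuleCat.{0} k} (hM : IsLfdMod k M) {f : M ⟶ N}
    (hf : Irred k f) {S : Finset A} (hS : ¬ SplitOn S f) : CogenAt S (kernel f) := by
  let i : closure S (kernel f) (fun _ => ⊥) ⟶ M := closureι S (kernel f) _ ≫ kernel.ι f
  have hzero : ∀ a ∈ S, ∀ x, i.app a x = 0 := by
    intro a ha x
    have := (Submodule.mem_bot k).1 (closureι_mem ha x)
    rw [comp_app_apply, this, map_zero]
  have hif : i ≫ f = 0 := by simp [i]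
  rcases hf.2.2 (hM.of_epi (cokernel.π i)) (cokernel.π i) (cokernel.desc i f hif) (by simp)
    with h | h
  · have hi : i = 0 := by
      have := cokernel.condition i
      rwa [← cancel_mono (cokernel.π i), zero_comp]
    have hmono : Mono i := mono_comp _ _
    intro c x hx
    obtain ⟨y, rfl⟩ := exists_closureι_eq (S := S) (p := fun _ => ⊥) x
      fun a ha g => (Submodule.mem_bot k).2 (hx a ha g)
    have hy : y = 0 := (mono_iff_app_injective i).1 hmono c (by rw [hi]; rfl)
    rw [hy, map_zero]
  · refine absurd (splitOn_of_comp (cokernel.π i) _ (by simp) (fun a ha => ⟨?_, ?_⟩) h) hS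
    · rw [injective_iff_map_eq_zero]
      intro x hx
      obtain ⟨y, rfl⟩ := exists_of_cokernel_π_eq_zero i a x hx
      exact hzero a ha y
    · exact (epi_iff_app_surjective _).1 inferInstance a

/-- Let `h : M ⟶ E` extend a monomorphism `j : ker f ⟶ E`. If the elements of `N` that vanish
at `S` lift to elements of `M` killed by `h`, then the cokernel of `j` is co-generated at `S`. -/
lemma Irred.cogenAt_cokernel {M N E : A ⥤ ModuleCat.{0} k}
    (hN : IsLfdMod k N) (hE : IsLfdMod k E) {f : M ⟶ N} (hf : Irred k f) {S : Finset A}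
    (hS : ¬ SplitOn S f) (hSE : CogenAt S E) (j : kernel f ⟶ E) [Mono j] (h : M ⟶ E)
    (hj : kernel.ι f ≫ h = j)
    (hlift : ∀ c (n : N.obj c), (∀ a ∈ S, ∀ g : c ⟶ a, N.map g n = 0) →
      ∃ m, f.app c m = n ∧ h.app c m = 0) :
    CogenAt S (cokernel j) := by
  let i : M ⟶ prodFunctor E N := prodLift h f
  have hi : ∀ c (m : M.obj c), i.app c m = (h.app c m, f.app c m) := fun _ _ => rfl
  have hinj : ∀ c, Function.Injective (i.app c) := by
    intro c
    rw [injective_iff_map_eq_zero]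
    intro m hm
    rw [hi] at hm
    obtain ⟨l, rfl⟩ := exists_kernel_ι_eq f c m (congrArg Prod.snd hm)
    have hl : j.app c l = 0 := by
      rw [← hj]
      exact congrArg Prod.fst hm
    rw [(mono_iff_app_injective j).1 inferInstance c (hl.trans (map_zero _).symm), map_zero]
  let p : ∀ c, Submodule k ((prodFunctor E N).obj c) := fun c => LinearMap.range (i.app c).hom
  let P := closure S (prodFunctor E N) p
  let ι : P ⟶ prodFunctor E N := closureι S _ p
  let u : M ⟶ P := closureLift i fun a _ x => ⟨x, rfl⟩
  have hu : u ≫ ι = i := closureLift_ι _ _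
  have hu' : ∀ c m, ι.app c (u.app c m) = i.app c m := fun _ _ => rfl
  have hsurj : ∀ a ∈ S, Function.Surjective (u.app a) := by
    intro a ha x
    obtain ⟨m, hm⟩ := closureι_mem ha x
    exact ⟨m, closureι_injective _ _ _ _ hm⟩
  have huinj : ∀ c, Function.Injective (u.app c) := fun c x y hxy => hinj c (by
    rw [← hu', ← hu', hxy])
  have hP : IsLfdMod k P := (hE.prodFunctor hN).of_mono ι
  rcases hf.2.2 hP u (ι ≫ prodSnd E N) rfl with ⟨⟨r, hr⟩⟩ | hsplit
  swap
  · exact absurd (splitOn_of_comp u _ rfl (fun a ha => ⟨huinj a, hsurj a ha⟩) hsplit) hS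
  have hr' : ∀ c m, r.app c (u.app c m) = m := fun c m => by
    rw [← comp_app_apply, hr]; rfl
  have hker : ∀ c (x : P.obj c), r.app c x = 0 → ∃ m, u.app c m = x := by
    intro c x hx
    have hvan : ∀ a ∈ S, ∀ g : c ⟶ a, P.map g x = 0 := by
      intro a ha g
      obtain ⟨m, hm⟩ := hsurj a ha (P.map g x)
      have : m = 0 := by rw [← hr' a m, hm, app_map, hx, map_zero]
      rw [← hm, this, map_zero]
    have hvan' : ∀ a ∈ S, ∀ g : c ⟶ a, (prodFunctor E N).map g (ι.app c x) = 0 := by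
      intro a ha g
      rw [← app_map, hvan a ha g, map_zero]
    have h1 : (ι.app c x).1 = 0 := hSE _ fun a ha g => congrArg Prod.fst (hvan' a ha g)
    obtain ⟨m, hm, hm'⟩ := hlift c (ι.app c x).2
      fun a ha g => congrArg Prod.snd (hvan' a ha g)
    refine ⟨m, closureι_injective _ _ _ _ ?_⟩
    change ι.app c (u.app c m) = ι.app c x
    rw [hu', hi]
    exact Prod.ext (hm'.trans h1.symm) hm
  have husurj : ∀ c (x : P.obj c), ∃ m, u.app c m = x := by
    intro c x
    obtain ⟨m, hm⟩ := hker c (x - u.app c (r.app c x)) (by rw [map_sub, hr', sub_self])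
    exact ⟨m + r.app c x, by rw [map_add, hm, sub_add_cancel]⟩
  intro c y hy
  obtain ⟨e, rfl⟩ := (epi_iff_app_surjective (cokernel.π j)).1 inferInstance c y
  obtain ⟨x, hx⟩ := exists_closureι_eq (S := S) (Y := prodFunctor E N) (p := p) (c := c)
    ((e, 0) : E.obj c × N.obj c) (by
      intro a ha g
      obtain ⟨l, hl⟩ := exists_of_cokernel_π_eq_zero j a (E.map g e) (by
        rw [app_map]; exact hy a ha g)
      refine ⟨(kernel.ι f).app a l, ?_⟩
      change i.app a _ = ((E.map g e, N.map g 0) : E.obj a × N.obj a)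
      rw [hi, app_apply_of_comp_eq_zero (kernel.condition f), ← comp_app_apply, hj, hl, map_zero])
  obtain ⟨m, rfl⟩ := husurj c x
  have hm : ((h.app c m, f.app c m) : E.obj c × N.obj c) = (e, 0) := hx
  obtain ⟨l, rfl⟩ := exists_kernel_ι_eq f c m (congrArg Prod.snd hm)
  have : j.app c l = e := by
    rw [← hj]
    exact congrArg Prod.fst hm
  rw [← this]
  exact app_apply_of_comp_eq_zero (cokernel.condition j) c l

/-- If the inclusion of `ker f` is irreducible, then the elements of `N` that vanish at `S` lift
to elements of `M` killed by a given morphism to a functor co-generated at `S`. -/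
lemma exists_lift_of_irred_kernel_ι {M N E : A ⥤ ModuleCat.{0} k} (hM : IsLfdMod k M)
    {f : M ⟶ N} [Epi f] (hι : Irred k (kernel.ι f)) {S : Finset A} (hS : ¬ SplitOn S f)
    (hSE : CogenAt S E) (h : M ⟶ E) (c : A) (n : N.obj c)
    (hn : ∀ a ∈ S, ∀ g : c ⟶ a, N.map g n = 0) : ∃ m, f.app c m = n ∧ h.app c m = 0 := by
  have hfsurj := (epi_iff_app_surjective f).1 inferInstance
  let p : ∀ c, Submodule k (M.obj c) := fun c => LinearMap.ker (f.app c).hom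
  let ι := closureι S M p
  let u : kernel f ⟶ closure S M p := closureLift (kernel.ι f) fun a _ x =>
    app_apply_of_comp_eq_zero (kernel.condition f) a x
  have hu : ∀ c x, ι.app c (u.app c x) = (kernel.ι f).app c x := fun _ _ => rfl
  rcases hι.2.2 (hM.of_mono ι) u ι rfl with ⟨⟨r, hr⟩⟩ | ⟨⟨σ, hσ⟩⟩
  swap
  · refine absurd (splitOn_of_forall_eq_zero f fun a ha x => ?_) hS
    obtain ⟨m, rfl⟩ := hfsurj a x
    have : ι.app a (σ.app a m) = m := by
      rw [← comp_app_apply, hσ]; rfl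
    rw [← this]
    exact closureι_mem ha (σ.app a m)
  have hr' : ∀ c x, r.app c (u.app c x) = x := fun c x => by
    rw [← comp_app_apply, hr]; rfl
  obtain ⟨m, rfl⟩ := hfsurj c n
  obtain ⟨y, rfl⟩ := exists_closureι_eq (S := S) (p := p) m fun a ha g => by
    change f.app a _ = 0
    rw [app_map]
    exact hn a ha g
  change ∃ m, f.app c m = f.app c (ι.app c y) ∧ _
  have hz : r.app c (y - u.app c (r.app c y)) = 0 := by rw [map_sub, hr', sub_self]
  refine ⟨ι.app c (y - u.app c (r.app c y)), ?_, hSE _ fun a ha g => ?_⟩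
  · rw [map_sub, map_sub, hu, app_apply_of_comp_eq_zero (kernel.condition f), sub_zero]
  · generalize y - u.app c (r.app c y) = z at hz
    rw [← app_map, ← app_map]
    have hz' : r.app a ((closure S M p).map g z) = 0 := by rw [app_map, hz, map_zero]
    obtain ⟨l, hl⟩ := exists_kernel_ι_eq f a (ι.app a ((closure S M p).map g z))
      (closureι_mem (p := p) ha ((closure S M p).map g z))
    have hl' : u.app a l = (closure S M p).map g z := closureι_injective _ _ _ _ hl
    have : l = 0 := by rw [← hr' a l, hl', hz']
    rw [← hl, this, map_zero, map_zero]

end Irreducible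

variable (k : Type) [Field k] [IsAlgClosed k]
variable (A : Type) [Category.{0} A] [Preadditive A] [CategoryTheory.Linear k A]

/-- Let `f : M ⟶ N` be an irreducible epimorphism in `mod A`. If `N` is finitely
co-generated then `ker f` is finitely co-presented; likewise, if the canonical morphism
`ker f ⟶ M` is also irreducible then `ker f` is finitely co-presented. -/
theorem statement_9 [Spectroid k A] {M N : A ⥤ ModuleCat.{0} k}
    (hM : IsLfdMod k M) (hN : IsLfdMod k N) (f : M ⟶ N) (hepi : Epi f)
    (hirr : Irred k f) :
    (IsFCG k N → IsFCP k (kernel f)) ∧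
      (Irred k (kernel.ι f) → IsFCP k (kernel f)) := by
  obtain ⟨S₁, hS₁⟩ := exists_not_splitOn hM.2 hN.2 hirr.2.1
  obtain ⟨s, b, j, hj⟩ := (hirr.cogenAt_kernel hM hS₁).isFCG (hM.of_mono (kernel.ι f))
  obtain ⟨h, hh⟩ := exists_extension_biproduct_injAt hM.1 (kernel.ι f) b j
  obtain ⟨S₂, hS₂⟩ := exists_cogenAt_biproduct_injAt (k := k) b
  have hE := isLfdMod_biproduct_injAt (k := k) b
  classical
  have key : ∀ S : Finset A, S₁ ∪ S₂ ⊆ S →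
      (∀ c (n : N.obj c), (∀ a ∈ S, ∀ g : c ⟶ a, N.map g n = 0) →
        ∃ m, f.app c m = n ∧ h.app c m = 0) → IsFCP k (kernel f) := fun S hS hlift =>
    ⟨s, b, j, hj, (hirr.cogenAt_cokernel hN hE
      (fun hs => hS₁ (hs.anti (Finset.union_subset_left hS)))
      (hS₂.mono (Finset.union_subset_right hS)) j h hh hlift).isFCG (hE.of_epi (cokernel.π j))⟩
  refine ⟨fun hNcog => ?_, fun hι => ?_⟩
  · obtain ⟨S₃, hS₃⟩ := hNcog.exists_cogenAt
    refine key (S₁ ∪ S₂ ∪ S₃) Finset.subset_union_left fun c n hn => ⟨0, ?_, map_zero _⟩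
    rw [map_zero, hS₃.mono Finset.subset_union_right n hn]
  · exact key (S₁ ∪ S₂) subset_rfl (exists_lift_of_irred_kernel_ι hM hι
      (fun hs => hS₁ (hs.anti Finset.subset_union_left)) (hS₂.mono Finset.subset_union_right) h)

end Paper
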